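/- arXiv:0904.2685 — 6 statements merged into one kernel-verified Lean document; each statement's English description precedes it below -/
import Mathlib

section
/- Let R be a left noetherian (associative, unital) ring, let α be an infinite cardinal, and let M be a left R-module that can be generated by a set of cardinality at most α. Then every submodule of M can be generated by a set of cardinality at most α. -/
/-- Let `R` be a left noetherian ring, `α` an infinite cardinal, and `M` a
left `R`-module generated by a set of cardinality at most `α`. Then every submodule of `M`
is generated by a set of cardinality at most `α`. -/
theorem stmt0 {R : Type u} [Ring R] [IsNoetherianRing R]
    {M : Type v} [AddCommGroup M] [Module R M]
    (α : Cardinal.{v}) (hα : Cardinal.aleph0 ≤ α)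
    (hM : ∃ S : Set M, Cardinal.mk S ≤ α ∧ Submodule.span R S = ⊤)
    (N : Submodule R M) :
    ∃ S : Set M, Cardinal.mk S ≤ α ∧ Submodule.span R S = N := by
  classical
  obtain ⟨S, hS, htop⟩ := hM
  have key : ∀ T : Finset S, ∃ G : Finset M,
      Submodule.span R (G : Set M) = N ⊓ Submodule.span R (Set.image Subtype.val (T : Set S)) := by
    intro T
    have hfin : (Set.image Subtype.val (T : Set S) : Set M).Finite := T.finite_toSet.image _
    have := isNoetherian_span_of_finite R hfin
    exact isNoetherian_submodule.1 this _ inf_le_right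
  choose G hG using key
  refine ⟨⋃ T, (G T : Set M), ?_, ?_⟩
  · have hF : Cardinal.mk (Finset S) ≤ α := by
      rcases finite_or_infinite S with h | h
      · exact (Cardinal.mk_le_aleph0).trans hα
      · rw [Cardinal.mk_finset_of_infinite]; exact hS
    calc Cardinal.mk (⋃ T, (G T : Set M) : Set M)
        ≤ Cardinal.mk (Finset S) * ⨆ T, Cardinal.mk (G T : Set M) := Cardinal.mk_iUnion_le _
      _ ≤ α * α := mul_le_mul' hF (ciSup_le' fun T =>
          ((G T).finite_toSet.lt_aleph0.le).trans hα)
      _ = α := Cardinal.mul_eq_self hα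
  · apply le_antisymm
    · rw [Submodule.span_iUnion]
      exact iSup_le fun T => (hG T).le.trans inf_le_left
    · intro x hx
      have hxS : x ∈ Submodule.span R S := htop ▸ Submodule.mem_top
      obtain ⟨T, hTS, hxT⟩ := Submodule.mem_span_finite_of_mem_span hxS
      let U : Finset S := T.subtype (· ∈ S)
      have hsub : (T : Set M) ⊆ Set.image Subtype.val (U : Set S) := fun y hy =>
        ⟨⟨y, hTS hy⟩, by simpa [U] using hy, rfl⟩
      have hm : x ∈ Submodule.span R (G U : Set M) := by
        rw [hG U]
        exact ⟨hx, Submodule.span_mono hsub hxT⟩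
      exact Submodule.span_mono (Set.subset_iUnion (fun T => (G T : Set M)) U) hm
end

section
/- Let α be an infinite cardinal and let R be an (associative, unital) ring that is either left noetherian or whose underlying set has cardinality at most α. Let κ be a regular cardinal with κ > α. If a left R-module M can be generated by a set of cardinality strictly less than κ, then every submodule of M can be generated by a set of cardinality strictly less than κ. -/
theorem mk_finset_lt_aux {X : Type u} (κ : Cardinal.{u}) (h0 : Cardinal.aleph0 < κ)
    (hX : Cardinal.mk X < κ) : Cardinal.mk (Finset X) < κ := by
  rcases finite_or_infinite X with h | h
  · exact (Cardinal.mk_lt_aleph0 (α := Finset X)).trans h0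
  · rwa [Cardinal.mk_finset_of_infinite]

/-- Let `α` be an infinite cardinal and `R` a ring which is either left
noetherian or of cardinality at most `α`. Let `κ > α` be a regular cardinal. If a left
`R`-module `M` is generated by a set of cardinality `< κ`, then every submodule of `M` is
generated by a set of cardinality `< κ`. -/
theorem stmt2 {R : Type u} [Ring R]
    {M : Type u} [AddCommGroup M] [Module R M]
    (α : Cardinal.{u}) (hα : Cardinal.aleph0 ≤ α)
    (hR : IsNoetherianRing R ∨ Cardinal.mk R ≤ α)
    (κ : Cardinal.{u}) (hκ : κ.IsRegular) (hακ : α < κ)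
    (hM : ∃ S : Set M, Cardinal.mk S < κ ∧ Submodule.span R S = ⊤)
    (N : Submodule R M) :
    ∃ S : Set M, Cardinal.mk S < κ ∧ Submodule.span R S = N := by
  classical
  obtain ⟨S, hS, hspan⟩ := hM
  have h0 : Cardinal.aleph0 < κ := hα.trans_lt hακ
  rcases hR with hR | hR
  · have hfin : ∀ T : Finset S, ∃ G : Set M, G.Finite ∧
        Submodule.span R G = N ⊓ Submodule.span R ((↑) '' (T : Set S)) := by
      intro T
      have hfg : (Submodule.span R (((↑) : S → M) '' (T : Set S))).FG :=
        Submodule.fg_span (T.finite_toSet.image _)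
      have hN : IsNoetherian R (Submodule.span R (((↑) : S → M) '' (T : Set S))) :=
        isNoetherian_of_fg_of_noetherian _ hfg
      have := (isNoetherian_submodule.mp hN) (N ⊓ Submodule.span R (((↑) : S → M) '' (T : Set S)))
        inf_le_right
      exact Submodule.fg_def.mp this
    choose G hG hGs using hfin
    refine ⟨⋃ T, G T, ?_, le_antisymm ?_ ?_⟩
    · refine (Cardinal.card_iUnion_lt_iff_forall_of_isRegular hκ
        (mk_finset_lt_aux κ h0 hS)).mpr ?_
      intro T
      exact ((hG T).lt_aleph0).trans h0
    · rw [Submodule.span_le]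
      refine Set.iUnion_subset fun T => ?_
      rw [← Submodule.span_le, hGs]
      exact inf_le_left
    · intro x hx
      have hxS : x ∈ Submodule.span R S := by rw [hspan]; trivial
      obtain ⟨T, hTS, hxT⟩ := Submodule.mem_span_finite_of_mem_span hxS
      have hx2 : x ∈ N ⊓ Submodule.span R
          (((↑) : S → M) '' ((T.subtype (· ∈ S) : Finset S) : Set S)) := by
        refine ⟨hx, Submodule.span_mono ?_ hxT⟩
        intro y hy
        exact ⟨⟨y, hTS hy⟩, by simpa using hy, rfl⟩
      rw [← hGs] at hx2
      exact Submodule.span_mono (Set.subset_iUnion G _) hx2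
  · refine ⟨N, ?_, Submodule.span_eq N⟩
    have hsurj : Function.Surjective (Finsupp.linearCombination R ((↑) : S → M)) := by
      rw [← LinearMap.range_eq_top, Finsupp.range_linearCombination, Subtype.range_coe, hspan]
    have h1 : Cardinal.mk (S →₀ R) ≤ Cardinal.mk (Finset (S × R)) :=
      Cardinal.mk_le_of_injective (Finsupp.graph_injective S R)
    have h2 : Cardinal.mk (S × R) < κ := by
      rw [← Cardinal.mul_def]
      exact Cardinal.mul_lt_of_lt hκ.aleph0_le hS (hR.trans_lt hακ)
    exact (Cardinal.mk_set_le _).trans_lt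
      (((Cardinal.mk_le_of_surjective hsurj).trans h1).trans_lt (mk_finset_lt_aux κ h0 h2))
end

section
/- Let R be an (associative, unital) ring and let F_0 → F_1 → F_2 → ⋯ be a sequence of chain maps φ_j : F_j → F_{j+1} of cochain complexes of left R-modules such that each φ_j induces the zero map on cohomology in every degree (each φ_j is a ghost map). Then the homotopy colimit of the sequence, namely the mapping cone of the chain map 1 − shift : ⨁_{j≥0} F_j → ⨁_{j≥0} F_j (whose restriction to the summand F_j is the difference of the inclusion of F_j and the composite of φ_j with the inclusion of F_{j+1}), is acyclic, i.e. has zero cohomology in every degree. -/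
open CategoryTheory CategoryTheory.Limits

namespace Stmt5Aux

variable {R : Type u} [Ring R] (F : ℕ → CochainComplex (ModuleCat.{u} R) ℤ)

/-- A submodule of a degree of a coproduct that contains every summand is everything. -/
lemma mem_of_summands (n : ℤ) (W : Submodule R ((∐ F).X n))
    (hW : ∀ (j : ℕ) (x : (F j).X n), (Sigma.ι F j).f n x ∈ W) (x : (∐ F).X n) : x ∈ W := by
  have h : ModuleCat.ofHom W.mkQ = 0 := by
    apply (isColimitOfPreserves (HomologicalComplex.eval (ModuleCat.{u} R) (ComplexShape.up ℤ) n)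
      (colimit.isColimit (Discrete.functor F))).hom_ext
    rintro ⟨j⟩
    ext y
    exact (Submodule.Quotient.mk_eq_zero W).2 (hW j y)
  have h2 : W.mkQ x = 0 := by
    have := congrArg (fun g => g.hom x) h
    exact this
  exact (Submodule.Quotient.mk_eq_zero W).1 h2

open Classical in
/-- The projection to a summand. -/
noncomputable def proj (j : ℕ) : (∐ F) ⟶ F j :=
  Sigma.desc (fun i => if h : i = j then eqToHom (by rw [h]) else 0)

lemma ι_proj_self (j : ℕ) : Sigma.ι F j ≫ proj F j = 𝟙 _ := by
  simp [proj]

lemma ι_proj_ne (i j : ℕ) (h : i ≠ j) : Sigma.ι F i ≫ proj F j = 0 := by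
  simp [proj, h]

/-- Truncation to the first `N` summands. -/
noncomputable def trunc (N : ℕ) : (∐ F) ⟶ (∐ F) :=
  ∑ j ∈ Finset.range N, proj F j ≫ Sigma.ι F j

lemma ι_trunc (i N : ℕ) (h : i < N) : Sigma.ι F i ≫ trunc F N = Sigma.ι F i := by
  rw [trunc, Preadditive.comp_sum, Finset.sum_eq_single i]
  · rw [← Category.assoc, ι_proj_self, Category.id_comp]
  · intro j _ hj
    rw [← Category.assoc, ι_proj_ne F i j hj.symm, zero_comp]
  · intro h'
    exact absurd (Finset.mem_range.2 h) h'

lemma exists_trunc (n : ℤ) (x : (∐ F).X n) : ∃ N, ∀ M ≥ N, (trunc F M).f n x = x := by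
  let W : Submodule R ((∐ F).X n) :=
    { carrier := {x | ∃ N, ∀ M ≥ N, (trunc F M).f n x = x}
      add_mem' := by
        rintro a b ⟨N, hN⟩ ⟨N', hN'⟩
        refine ⟨max N N', fun M hM => ?_⟩
        rw [map_add, hN M (le_trans (le_max_left _ _) hM), hN' M (le_trans (le_max_right _ _) hM)]
      zero_mem' := ⟨0, fun M _ => map_zero _⟩
      smul_mem' := by
        rintro r a ⟨N, hN⟩
        refine ⟨N, fun M hM => ?_⟩
        rw [map_smul, hN M hM] }
  refine mem_of_summands F n W (fun j y => ⟨j + 1, fun M hM => ?_⟩) x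
  have := ι_trunc F j M (by omega)
  have h2 := congrArg (fun g : F j ⟶ ∐ F => (HomologicalComplex.Hom.f g n).hom y) this
  exact h2

/-- A map out of a coproduct which is zero in homology on each summand is zero in homology. -/
lemma homologyMap_eq_zero {K : CochainComplex (ModuleCat.{u} R) ℤ} (s : (∐ F) ⟶ K) (n : ℤ)
    (hs : ∀ j, HomologicalComplex.homologyMap (Sigma.ι F j ≫ s) n = 0) :
    HomologicalComplex.homologyMap s n = 0 := by
  have ht : ∀ N, HomologicalComplex.homologyMap (trunc F N ≫ s) n = 0 := by
    intro N
    change (HomologicalComplex.homologyFunctor (ModuleCat.{u} R) (ComplexShape.up ℤ) n).map _ = 0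
    rw [trunc, Preadditive.sum_comp, Functor.map_sum]
    refine Finset.sum_eq_zero (fun j _ => ?_)
    rw [Category.assoc, Functor.map_comp]
    have := hs j
    change (HomologicalComplex.homologyFunctor (ModuleCat.{u} R) (ComplexShape.up ℤ) n).map _ = 0
      at this
    rw [this, comp_zero]
  rw [← cancel_epi (HomologicalComplex.homologyπ _ n), comp_zero]
  ext z
  obtain ⟨N, hN⟩ := exists_trunc F n ((∐ F).iCycles n z)
  have hz : HomologicalComplex.cyclesMap (trunc F N) n z = z := by
    apply (ModuleCat.mono_iff_injective ((∐ F).iCycles n)).1 inferInstance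
    have := congrArg (fun g => g.hom z) (HomologicalComplex.cyclesMap_i (trunc F N) n)
    exact this.trans (hN N le_rfl)
  have h1 : HomologicalComplex.cyclesMap (trunc F N) n ≫ (∐ F).homologyπ n ≫
      HomologicalComplex.homologyMap s n = 0 := by
    rw [← HomologicalComplex.homologyπ_naturality_assoc, ← HomologicalComplex.homologyMap_comp,
      ht, comp_zero]
  have h2 := congrArg (fun g => g.hom z) h1
  have h3 : ((∐ F).homologyπ n ≫ HomologicalComplex.homologyMap s n).hom
    (HomologicalComplex.cyclesMap (trunc F N) n z) = 0 := h2
  rw [hz] at h3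
  exact h3

end Stmt5Aux

/-- Let `R` be a ring and `F 0 ⟶ F 1 ⟶ F 2 ⟶ ⋯` a sequence of chain maps of
cochain complexes of left `R`-modules, each of which induces the zero map on cohomology in
every degree.  Then the homotopy colimit of the sequence, namely the mapping cone of the map
`1 - shift : ⨁ⱼ F j ⟶ ⨁ⱼ F j` (whose restriction to the summand `F j` is the difference of
the inclusion of `F j` and the composite of `φ j` with the inclusion of `F (j+1)`), is
acyclic. -/
theorem stmt5 {R : Type u} [Ring R]
    (F : ℕ → CochainComplex (ModuleCat.{u} R) ℤ)
    (φ : ∀ j : ℕ, F j ⟶ F (j + 1))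
    (ghost : ∀ (j : ℕ) (n : ℤ), HomologicalComplex.homologyMap (φ j) n = 0)
    (n : ℤ) :
    IsZero ((CochainComplex.mappingCone
      (Sigma.desc (fun j => Sigma.ι F j - (φ j ≫ Sigma.ι F (j + 1))))).homology n) := by
  set f := Sigma.desc (fun j => Sigma.ι F j - (φ j ≫ Sigma.ι F (j + 1))) with hf
  have hfs : f = 𝟙 _ - Limits.Sigma.desc (fun j => φ j ≫ Sigma.ι F (j + 1)) := by
    apply Sigma.hom_ext
    intro j
    simp [hf, Preadditive.comp_sub]
  have hq : QuasiIso f := by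
    rw [quasiIso_iff]
    intro m
    rw [quasiIsoAt_iff_isIso_homologyMap]
    have h0 : HomologicalComplex.homologyMap
        (Limits.Sigma.desc (fun j => φ j ≫ Sigma.ι F (j + 1))) m = 0 := by
      apply Stmt5Aux.homologyMap_eq_zero
      intro j
      rw [Sigma.ι_desc, HomologicalComplex.homologyMap_comp, ghost, zero_comp]
    rw [hfs, HomologicalComplex.homologyMap_sub, h0, sub_zero, HomologicalComplex.homologyMap_id]
    infer_instance
  have h1 : HomotopyCategory.quasiIso (ModuleCat.{u} R) (ComplexShape.up ℤ)
      ((HomotopyCategory.quotient _ _).map f) := by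
    rw [HomotopyCategory.quotient_map_mem_quasiIso_iff]
    exact hq
  rw [HomotopyCategory.quasiIso_eq_trW_subcategoryAcyclic] at h1
  have h2 := ((HomotopyCategory.subcategoryAcyclic (ModuleCat.{u} R)).trW_iff_of_distinguished _
    (HomotopyCategory.mappingCone_triangleh_distinguished f)).1 h1
  have h3 := (HomotopyCategory.quotient_obj_mem_subcategoryAcyclic_iff_exactAt _).1 h2 n
  exact (HomologicalComplex.exactAt_iff_isZero_homology _ _).1 h3
end

section
/- Let A and B be triangulated subcategories of a triangulated category T. The following are equivalent: (i) A⋆B = B⋆A; (ii) for every A ∈ A and B ∈ B, every morphism A → B factors as A → C → B for some object C ∈ A ∩ B, and every morphism B → A factors as B → C → A for some object C ∈ A ∩ B. -/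
open CategoryTheory CategoryTheory.Limits CategoryTheory.Pretriangulated

universe v u

variable {C : Type u} [Category.{v} C] [Preadditive C] [HasZeroObject C]
  [HasShift C ℤ] [∀ n : ℤ, (shiftFunctor C n).Additive] [Pretriangulated C]
  [IsTriangulated C]

/-- `VerdierStar A B` is the strictly full subcategory (here: class of objects) of those `X`
admitting a distinguished triangle `a ⟶ X ⟶ b ⟶ a⟦1⟧` with `a ∈ A` and `b ∈ B`. -/
def VerdierStar (A B : Set C) : Set C :=
  {X | ∃ (a b : C) (f : a ⟶ X) (g : X ⟶ b) (h : b ⟶ a⟦(1 : ℤ)⟧),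
    a ∈ A ∧ b ∈ B ∧ Triangle.mk f g h ∈ distTriang C}

/-- A triangulated subcategory: a strictly full class of objects closed under the shifts
`Σ`, `Σ⁻¹` and under mapping cones of morphisms between its objects. -/
def IsTriangulatedSub (A : Set C) : Prop :=
  (∀ ⦃X Y : C⦄, (X ≅ Y) → X ∈ A → Y ∈ A) ∧
  (∀ X : C, X ∈ A → (X⟦(1 : ℤ)⟧ ∈ A ∧ X⟦(-1 : ℤ)⟧ ∈ A)) ∧
  (∀ T : Triangle C, (T ∈ distTriang C) → T.obj₁ ∈ A → T.obj₂ ∈ A → T.obj₃ ∈ A)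

lemma octa_star {A B : Set C} (hA : IsTriangulatedSub A) (hB : IsTriangulatedSub B)
    (h : ∀ (a b : C), a ∈ A → b ∈ B → ∀ f : a ⟶ b,
        ∃ (c : C) (g : a ⟶ c) (h : c ⟶ b), c ∈ A ∩ B ∧ g ≫ h = f) :
    VerdierStar B A ⊆ VerdierStar A B := by
  rintro X ⟨b, a, i, p, d, hb, ha, hT⟩
  obtain ⟨c, g, k, ⟨hcA, hcB⟩, hgk⟩ := h a (b⟦(1 : ℤ)⟧) ha (hB.2.1 b hb).1 d
  obtain ⟨a1, v12, w12, h12⟩ := distinguished_cocone_triangle g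
  obtain ⟨b1, v23, w23, h23⟩ := distinguished_cocone_triangle k
  have h13 := rot_of_distTriang _ (rot_of_distTriang _ hT)
  have o := Triangulated.someOctahedron (u₁₃ := d) hgk h12 h23 h13
  have ha1 : a1 ∈ A := hA.2.2 _ h12 ha hcA
  have hb1 : b1 ∈ B := hB.2.2 _ h23 hcB (hB.2.1 b hb).1
  have hs := Triangle.shift_distinguished _ o.mem (-1)
  let e : X⟦(1 : ℤ)⟧⟦(-1 : ℤ)⟧ ≅ X := shiftShiftNeg X (1 : ℤ)
  let S := (Triangle.shiftFunctor C (-1)).obj o.triangle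
  refine ⟨S.obj₁, S.obj₃, S.mor₁ ≫ e.hom, e.inv ≫ S.mor₂, S.mor₃, (hA.2.1 _ ha1).2,
    (hB.2.1 _ hb1).2, isomorphic_distinguished S hs _ ?_⟩
  refine Triangle.isoMk _ _ (Iso.refl _) e.symm (Iso.refl _) ?_ ?_ ?_
  · change (S.mor₁ ≫ e.hom) ≫ e.inv = 𝟙 _ ≫ S.mor₁
    exact ((Category.assoc _ _ _).trans
      ((congrArg (fun t => S.mor₁ ≫ t) e.hom_inv_id).trans (Category.comp_id _))).trans
      (Category.id_comp _).symm
  · change (e.inv ≫ S.mor₂) ≫ 𝟙 _ = e.inv ≫ S.mor₂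
    simp
  · change S.mor₃ ≫ (𝟙 _)⟦(1 : ℤ)⟧' = 𝟙 _ ≫ S.mor₃
    simp

lemma factor_of_star {A B : Set C} (hA : IsTriangulatedSub A) (hB : IsTriangulatedSub B)
    (h : VerdierStar B A ⊆ VerdierStar A B) (a b : C) (ha : a ∈ A) (hb : b ∈ B) (f : a ⟶ b) :
    ∃ (c : C) (g : a ⟶ c) (h : c ⟶ b), c ∈ A ∩ B ∧ g ≫ h = f := by
  obtain ⟨X, p, q, hT⟩ := distinguished_cocone_triangle f
  have hT1 := rot_of_distTriang _ hT
  have hT2 := rot_of_distTriang _ hT1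
  obtain ⟨a', b', u, v, w, ha', hb', hu⟩ :=
    h (show X ∈ VerdierStar B A from ⟨b, _, _, _, _, hb, (hA.2.1 a ha).1, hT1⟩)
  obtain ⟨c, v13, w13, h13⟩ := distinguished_cocone_triangle (u ≫ q)
  have o := Triangulated.someOctahedron rfl hu hT2 h13
  have hcA : c ∈ A := hA.2.2 _ h13 ha' (hA.2.1 a ha).1
  have hcB : c ∈ B := hB.2.2 _ (inv_rot_of_distTriang _ o.mem)
    (hB.2.1 _ (hB.2.1 b hb).1).2 hb'
  obtain ⟨m, hc⟩ : ∃ m : c ⟶ b⟦(1 : ℤ)⟧, v13 ≫ m = -f⟦(1 : ℤ)⟧' := ⟨o.m₃, o.comm₃⟩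
  let e : c⟦(-1 : ℤ)⟧⟦(1 : ℤ)⟧ ≅ c := shiftNegShift c (1 : ℤ)
  refine ⟨c⟦(-1 : ℤ)⟧, (shiftFunctor C (1 : ℤ)).preimage (v13 ≫ e.inv),
    -(shiftFunctor C (1 : ℤ)).preimage (e.hom ≫ m),
    ⟨(hA.2.1 _ hcA).2, (hB.2.1 _ hcB).2⟩, ?_⟩
  apply (shiftFunctor C (1 : ℤ)).map_injective
  have h2 : (v13 ≫ e.inv) ≫ (e.hom ≫ m) = -f⟦(1 : ℤ)⟧' := by simpa using hc
  rw [Functor.map_comp, Functor.map_neg, Functor.map_preimage, Functor.map_preimage,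
    Preadditive.comp_neg, h2, neg_neg]

/-- For triangulated subcategories `A`, `B` of a triangulated category,
`A ⋆ B = B ⋆ A` holds if and only if every morphism `A ⟶ B` and every morphism `B ⟶ A`
(with `A ∈ A`, `B ∈ B`) factors through an object of `A ∩ B`. -/
theorem stmt7 (A B : Set C) (hA : IsTriangulatedSub A) (hB : IsTriangulatedSub B) :
    VerdierStar A B = VerdierStar B A ↔
      ((∀ (a b : C), a ∈ A → b ∈ B → ∀ f : a ⟶ b,
        ∃ (c : C) (g : a ⟶ c) (h : c ⟶ b), c ∈ A ∩ B ∧ g ≫ h = f) ∧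
       (∀ (a b : C), a ∈ A → b ∈ B → ∀ f : b ⟶ a,
        ∃ (c : C) (g : b ⟶ c) (h : c ⟶ a), c ∈ A ∩ B ∧ g ≫ h = f)) := by
  constructor
  · intro h
    exact ⟨factor_of_star hA hB h.ge, fun a b ha hb f =>
      (factor_of_star hB hA h.le b a hb ha f).imp
        fun c ⟨g, k, hc, e⟩ => ⟨g, k, ⟨hc.2, hc.1⟩, e⟩⟩
  · rintro ⟨h1, h2⟩
    exact Set.Subset.antisymm
      (octa_star hB hA fun b a hb ha f => (h2 a b ha hb f).imp
        fun c ⟨g, k, hc, e⟩ => ⟨g, k, ⟨hc.2, hc.1⟩, e⟩)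
      (octa_star hA hB h1)
end

section
/- Let A and B be triangulated subcategories of a triangulated category T that intersect properly, i.e. A⋆B = B⋆A. Then A⋆B is a triangulated subcategory of T; in particular, for every morphism f : X → Y with X, Y ∈ A⋆B, the mapping cone of f belongs to A⋆B. -/
open CategoryTheory CategoryTheory.Limits CategoryTheory.Pretriangulated

universe v u

variable {C : Type u} [Category.{v} C] [Preadditive C] [HasZeroObject C]
  [HasShift C ℤ] [∀ n : ℤ, (shiftFunctor C n).Additive] [Pretriangulated C]
  [IsTriangulated C]

/-- `VerdierStar` as Mathlib's `extensionProduct`. -/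
lemma mem_verdierStar_iff (A B : Set C) (X : C) :
    X ∈ VerdierStar A B ↔
      ObjectProperty.extensionProduct (fun Y : C => Y ∈ A) (fun Y : C => Y ∈ B) X := by
  constructor
  · rintro ⟨a, b, f, g, h, ha, hb, hT⟩
    exact ⟨a, b, f, g, h, hT, ha, hb⟩
  · rintro ⟨a, b, f, g, h, hT, ha, hb⟩
    exact ⟨a, b, f, g, h, ha, hb, hT⟩

lemma IsTriangulatedSub.ext₂ {A : Set C} (hA : IsTriangulatedSub A) :
    ObjectProperty.extensionProduct (fun Y : C => Y ∈ A) (fun Y : C => Y ∈ A) ≤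
      (fun Y : C => Y ∈ A) := by
  rintro X ⟨a, b, f, g, h, hT, ha, hb⟩
  exact hA.2.2 _ (inv_rot_of_distTriang _ hT) (hA.2.1 _ hb).2 ha

/-- A triangle-shift argument: `A ⋆ B` is closed under any shift under which `A`, `B` are. -/
lemma verdierStar_shift {A B : Set C} (n : ℤ) (hA : ∀ X ∈ A, X⟦n⟧ ∈ A)
    (hB : ∀ X ∈ B, X⟦n⟧ ∈ B) (X : C) (hX : X ∈ VerdierStar A B) :
    X⟦n⟧ ∈ VerdierStar A B := by
  obtain ⟨a, b, f, g, h, ha, hb, hT⟩ := hX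
  exact ⟨_, _, _, _, _, hA _ ha, hB _ hb, Triangle.shift_distinguished _ hT n⟩

lemma verdierStar_ext₂ {A B : Set C} (hA : IsTriangulatedSub A) (hB : IsTriangulatedSub B)
    (hproper : VerdierStar A B = VerdierStar B A) (X : C)
    (hX : ObjectProperty.extensionProduct (fun Y : C => Y ∈ VerdierStar A B)
      (fun Y : C => Y ∈ VerdierStar A B) X) : X ∈ VerdierStar A B := by
  let P : ObjectProperty C := fun Y => Y ∈ A
  let Q : ObjectProperty C := fun Y => Y ∈ B
  have hS : (fun Y : C => Y ∈ VerdierStar A B) = P.extensionProduct Q :=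
    funext fun Y => propext (mem_verdierStar_iff A B Y)
  have hS' : (fun Y : C => Y ∈ VerdierStar B A) = Q.extensionProduct P :=
    funext fun Y => propext (mem_verdierStar_iff B A Y)
  have hPQ : Q.extensionProduct P = P.extensionProduct Q := by
    rw [← hS, ← hS', hproper]
  have key : (P.extensionProduct Q).extensionProduct (P.extensionProduct Q) =
      (P.extensionProduct P).extensionProduct (Q.extensionProduct Q) := by
    rw [ObjectProperty.extensionProduct_assoc, ← ObjectProperty.extensionProduct_assoc Q P Q,
      hPQ, ObjectProperty.extensionProduct_assoc P Q Q,
      ← ObjectProperty.extensionProduct_assoc P P]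
  rw [hS, key] at hX
  rw [mem_verdierStar_iff]
  exact ObjectProperty.monotone_extensionProduct_left _ hA.ext₂ _
    (ObjectProperty.monotone_extensionProduct_right _ hB.ext₂ _ hX)

/-- If `A` and `B` are properly intersecting triangulated subcategories of a
triangulated category (i.e. `A ⋆ B = B ⋆ A`), then `A ⋆ B` is a triangulated subcategory; in
particular, for every morphism `f : X ⟶ Y` with `X, Y ∈ A ⋆ B`, any mapping cone of `f`
belongs to `A ⋆ B`. -/
theorem stmt8 (A B : Set C) (hA : IsTriangulatedSub A) (hB : IsTriangulatedSub B)
    (hproper : VerdierStar A B = VerdierStar B A) :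
    IsTriangulatedSub (VerdierStar A B) ∧
      ∀ (X Y Z : C) (f : X ⟶ Y) (g : Y ⟶ Z) (h : Z ⟶ X⟦(1 : ℤ)⟧),
        (Triangle.mk f g h ∈ distTriang C) →
          X ∈ VerdierStar A B → Y ∈ VerdierStar A B → Z ∈ VerdierStar A B := by
  have hshift : ∀ X : C, X ∈ VerdierStar A B →
      (X⟦(1 : ℤ)⟧ ∈ VerdierStar A B ∧ X⟦(-1 : ℤ)⟧ ∈ VerdierStar A B) := fun X hX =>
    ⟨verdierStar_shift 1 (fun Y hY => (hA.2.1 Y hY).1) (fun Y hY => (hB.2.1 Y hY).1) X hX,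
      verdierStar_shift (-1) (fun Y hY => (hA.2.1 Y hY).2) (fun Y hY => (hB.2.1 Y hY).2) X hX⟩
  have hcone : ∀ T : Triangle C, (T ∈ distTriang C) → T.obj₁ ∈ VerdierStar A B →
      T.obj₂ ∈ VerdierStar A B → T.obj₃ ∈ VerdierStar A B := fun T hT h₁ h₂ =>
    verdierStar_ext₂ hA hB hproper _
      ⟨_, _, _, _, _, rot_of_distTriang _ hT, h₂, (hshift _ h₁).1⟩
  refine ⟨⟨?_, hshift, hcone⟩, fun X Y Z f g h hT hX hY => hcone _ hT hX hY⟩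
  intro X Y e hX
  rw [mem_verdierStar_iff] at hX ⊢
  exact ObjectProperty.prop_of_iso _ e hX
end

section
/- Let R be a commutative (unital) ring, α an infinite cardinal, and F an R-module. Let f_1, …, f_r ∈ R be elements generating the unit ideal of R. If for each i ∈ {1, …, r} the localization F[f_i⁻¹] can be generated as an R[f_i⁻¹]-module by a set of cardinality at most α, then F can be generated as an R-module by a set of cardinality at most α. -/
/-- Let `R` be a commutative ring, `α` an infinite cardinal, `F` an
`R`-module, and `f 1, …, f r` elements of `R` generating the unit ideal. If each localization
`F[f i⁻¹]` is generated over `R[f i⁻¹]` by a set of cardinality at most `α`, then `F` is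
generated over `R` by a set of cardinality at most `α`. -/
theorem stmt15 {R : Type u} [CommRing R]
    {F : Type u} [AddCommGroup F] [Module R F]
    (α : Cardinal.{u}) (hα : Cardinal.aleph0 ≤ α)
    (r : ℕ) (f : Fin r → R) (hunit : Ideal.span (Set.range f) = ⊤)
    (hloc : ∀ i : Fin r,
      ∃ S : Set (LocalizedModule (Submonoid.powers (f i)) F),
        Cardinal.mk S ≤ α ∧
          Submodule.span (Localization (Submonoid.powers (f i))) S = ⊤) :
    ∃ S : Set F, Cardinal.mk S ≤ α ∧ Submodule.span R S = ⊤ := by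
  classical
  choose S hS hspan using hloc
  have hnum : ∀ (i : Fin r) (y : LocalizedModule (Submonoid.powers (f i)) F),
      ∃ p : F × Submonoid.powers (f i), y = LocalizedModule.mk p.1 p.2 := by
    intro i y
    induction y using LocalizedModule.induction_on with
    | h m s => exact ⟨(m, s), rfl⟩
  choose num hn using hnum
  let A : Fin r → Set F := fun i => Set.image (fun y => (num i y).1) (S i)
  let T : Set F := ⋃ i : Fin r, A i
  refine ⟨T, ?_, ?_⟩
  · have hle : ∀ i : Fin r, Cardinal.mk (A i) ≤ α := fun i =>
      le_trans (Cardinal.mk_image_le (f := fun y => (num i y).1) (s := S i)) (hS i)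
    clear_value A
    have h1 := Cardinal.mk_iUnion_le_sum_mk_lift (f := A)
    rw [Cardinal.lift_id'.{0, u}] at h1
    refine h1.trans ?_
    refine (Cardinal.sum_le_sum _ (fun _ => α) hle).trans ?_
    rw [Cardinal.sum_const, Cardinal.lift_id'.{0, u}]
    refine Cardinal.mul_le_of_le hα ?_ le_rfl
    exact (Cardinal.lift_le_aleph0.2 Cardinal.mk_le_aleph0).trans hα
  · rw [eq_top_iff]
    rintro x -
    refine Submodule.mem_of_span_eq_top_of_smul_pow_mem _ _ hunit x ?_
    rintro ⟨_, i, rfl⟩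
    have key : ∀ y : LocalizedModule (Submonoid.powers (f i)) F,
        ∃ n ∈ Submodule.span R T, ∃ t, y = LocalizedModule.mk n t := by
      intro y
      have hy : y ∈ Submodule.span (Localization (Submonoid.powers (f i))) (S i) := by
        rw [hspan]; trivial
      induction hy using Submodule.span_induction with
      | mem y hy =>
        exact ⟨_, Submodule.subset_span (Set.mem_iUnion.2 ⟨i, y, hy, rfl⟩), _, hn i y⟩
      | zero => exact ⟨0, zero_mem _, 1, (LocalizedModule.zero_mk 1).symm⟩
      | add a b _ _ ha hb =>
        obtain ⟨n, hn, t, rfl⟩ := ha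
        obtain ⟨m, hm, s, rfl⟩ := hb
        refine ⟨_, ?_, _, LocalizedModule.mk_add_mk⟩
        exact add_mem (Submodule.smul_mem _ _ hn) (Submodule.smul_mem _ _ hm)
      | smul a b _ hb =>
        obtain ⟨n, hn, t, rfl⟩ := hb
        induction a using Localization.induction_on with
        | H p =>
          exact ⟨_, Submodule.smul_mem _ _ hn, _, LocalizedModule.mk_smul_mk _ _ _ _⟩
    obtain ⟨n, hn, t, h⟩ := key (LocalizedModule.mk x 1)
    rw [LocalizedModule.mk_eq] at h
    obtain ⟨u, h⟩ := h
    obtain ⟨k, hk⟩ := (u * t).2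
    refine ⟨k, ?_⟩
    have h2 : (f i) ^ k • x = (u : R) • n := by
      have hk' : f i ^ k = ((u * t : Submonoid.powers (f i)) : R) := hk
      rw [hk', Submonoid.coe_mul, mul_smul]
      simpa [Submonoid.smul_def] using h
    change f i ^ k • x ∈ _
    rw [h2]
    exact Submodule.smul_mem _ _ hn
end
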